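/- Fix θ, σ, t > 0 and 0 ≤ a < b ≤ π. Let u : [0,π] → (Ω → ℝ) be a centered Gaussian random field with covariance E[u(x)u(y)] = Σ_{k=1}^∞ (σ²/(θπk²)) (1 − e^{−2θk²t}) sin(kx) sin(ky), and set x_j := a + (b−a)j/m. Then the estimator σ̂²_{m,t} := (2θ/(b−a)) Σ_{j=1}^m ( u(x_j) − u(x_{j−1}) )² converges in probability to σ² as m → ∞. -/

import Mathlib

open MeasureTheory ProbabilityTheory Real Filter

noncomputable section

/-- `u` is a centered Gaussian random field on `S` with covariance function `C`:
every finite linear combination of its values at points of `S` is a centered real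
Gaussian with the corresponding variance. -/
def IsCenteredGaussianField {Ω : Type*} [MeasurableSpace Ω] (P : Measure Ω)
    (u : ℝ → Ω → ℝ) (S : Set ℝ) (C : ℝ → ℝ → ℝ) : Prop :=
  ∀ (n : ℕ) (x : Fin n → ℝ), (∀ i, x i ∈ S) → ∀ a : Fin n → ℝ,
    Measure.map (fun ω => ∑ i, a i * u (x i) ω) P
      = gaussianReal 0 (∑ i, ∑ j, a i * a j * C (x i) (x j)).toNNReal

/-- Spatial covariance, at a fixed time `t`, of the solution of the stochastic heat
equation `du − θΔu dt = σ dW` on `[0, π]` with zero initial and Dirichlet boundary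
conditions: `E[u(x)u(y)] = Σ_{k≥1} (σ²/(θπk²))(1 − e^{−2θk²t}) sin(kx) sin(ky)`. -/
def heatCovSpace (θ σ t x y : ℝ) : ℝ :=
  ∑' k : ℕ, (σ ^ 2 / (θ * π * ((k : ℝ) + 1) ^ 2)) *
    (1 - Real.exp (-(2 * θ * ((k : ℝ) + 1) ^ 2 * t))) *
    Real.sin (((k : ℝ) + 1) * x) * Real.sin (((k : ℝ) + 1) * y)


lemma integral_pow_four_gaussianReal (v : NNReal) :
    ∫ x, x ^ 4 ∂(gaussianReal 0 v) = 3 * (v : ℝ) ^ 2 := by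
  have h0 : (0 : ℝ) ∈ interior (integrableExpSet id (gaussianReal 0 v)) := by simp
  have hderiv : ∀ (p p' : ℝ → ℝ), (∀ t, HasDerivAt p (p' t) t) →
      deriv (fun t => p t * exp (v * t ^ 2 / 2))
        = fun t => (p' t + p t * (v * t)) * exp (v * t ^ 2 / 2) := by
    intro p p' hp
    funext t
    have h1 : HasDerivAt (fun t : ℝ => (v : ℝ) * t ^ 2 / 2) (v * t) t := by
      have := (((hasDerivAt_id t).pow 2).const_mul (v : ℝ)).div_const 2
      convert! this using 1
      simp; ring
    have := ((hp t).mul h1.exp).deriv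
    rw [show (fun t => p t * exp (v * t ^ 2 / 2)) = p * fun t => exp (v * t ^ 2 / 2) from rfl, this]
    ring
  have h := iteratedDeriv_mgf_zero h0 4
  rw [mgf_id_gaussianReal] at h
  have hm : (fun t : ℝ => exp (0 * t + v * t ^ 2 / 2)) =
      fun t => (fun _ => (1 : ℝ)) t * exp (v * t ^ 2 / 2) := by
    funext t; simp
  have d1 := hderiv (fun _ => 1) (fun _ => 0) (fun t => hasDerivAt_const t 1)
  have d2 := hderiv (fun t => 0 + 1 * ((v : ℝ) * t)) (fun _ => v) (fun t => by
    simpa using (hasDerivAt_id t).const_mul (v : ℝ))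
  have d3 := hderiv (fun t => (v : ℝ) + (0 + 1 * (v * t)) * (v * t)) (fun t => 2 * v ^ 2 * t)
    (fun t => by
      have := (((hasDerivAt_id t).pow 2).const_mul ((v : ℝ) ^ 2)).const_add (v : ℝ)
      convert! this using 1
      · funext t; simp; ring
      · simp; ring)
  have d4 := hderiv (fun t => 2 * (v : ℝ) ^ 2 * t + (v + (0 + 1 * (v * t)) * (v * t)) * (v * t))
    (fun t => 3 * v ^ 2 + 3 * v ^ 3 * t ^ 2)
    (fun t => by
      have := (((hasDerivAt_id t).pow 3).const_mul ((v : ℝ) ^ 3)).add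
        ((hasDerivAt_id t).const_mul (3 * (v : ℝ) ^ 2))
      convert! this using 1
      · funext t; simp; ring
      · simp; ring)
  rw [hm, iteratedDeriv_eq_iterate] at h
  simp only [Function.iterate_succ, Function.iterate_zero, Function.comp_apply, id_eq] at h
  rw [d1, d2, d3, d4] at h
  simpa using h.symm

lemma integral_pow_two_gaussianReal (v : NNReal) :
    ∫ x, x ^ 2 ∂(gaussianReal 0 v) = (v : ℝ) := by
  have h := variance_fun_id_gaussianReal (μ := 0) (v := v)
  rw [variance_eq_integral (by fun_prop)] at h
  simpa using h

section Gaussian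

variable {Ω : Type*} [MeasurableSpace Ω] {P : Measure Ω}

lemma aemeasurable_of_map_eq_gaussianReal {X : Ω → ℝ} {μ : ℝ} {v : NNReal}
    (h : Measure.map X P = gaussianReal μ v) : AEMeasurable X P := by
  by_contra hX
  rw [Measure.map_of_not_aemeasurable hX] at h
  exact IsProbabilityMeasure.ne_zero (gaussianReal μ v) h.symm

lemma memLp_of_map_eq_gaussianReal {X : Ω → ℝ} {μ : ℝ} {v : NNReal}
    (h : Measure.map X P = gaussianReal μ v) (p : NNReal) : MemLp X p P := by
  have hX := aemeasurable_of_map_eq_gaussianReal h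
  have := memLp_id_gaussianReal (μ := μ) (v := v) p
  rw [← h, memLp_map_measure_iff (by fun_prop) hX] at this
  exact this

lemma integral_pow_four_of_map_eq_gaussianReal {X : Ω → ℝ} {c : ℝ} (hc : 0 ≤ c)
    (h : Measure.map X P = gaussianReal 0 c.toNNReal) : ∫ ω, X ω ^ 4 ∂P = 3 * c ^ 2 := by
  have := integral_pow_four_gaussianReal c.toNNReal
  rwa [← h, integral_map (aemeasurable_of_map_eq_gaussianReal h) (by fun_prop),
    Real.coe_toNNReal c hc] at this

lemma integral_pow_two_of_map_eq_gaussianReal {X : Ω → ℝ} {c : ℝ} (hc : 0 ≤ c)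
    (h : Measure.map X P = gaussianReal 0 c.toNNReal) : ∫ ω, X ω ^ 2 ∂P = c := by
  have := integral_pow_two_gaussianReal c.toNNReal
  rwa [← h, integral_map (aemeasurable_of_map_eq_gaussianReal h) (by fun_prop),
    Real.coe_toNNReal c hc] at this

lemma integrable_pow_four {X : Ω → ℝ} (hX : MemLp X 4 P) : Integrable (fun ω => X ω ^ 4) P := by
  have := hX.integrable_norm_pow (p := 4) (by norm_num)
  simpa [Even.pow_abs (show Even 4 by decide)] using this

/-- `X` and `Y` are jointly centered Gaussian with variances `vX`, `vY` and covariance `c`. -/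
def IsGaussianPair (P : Measure Ω) (X Y : Ω → ℝ) (vX vY c : ℝ) : Prop :=
  ∀ p q : ℝ, 0 ≤ p ^ 2 * vX + 2 * p * q * c + q ^ 2 * vY ∧
    Measure.map (fun ω => p * X ω + q * Y ω) P
      = gaussianReal 0 (p ^ 2 * vX + 2 * p * q * c + q ^ 2 * vY).toNNReal

namespace IsGaussianPair

variable {X Y : Ω → ℝ} {vX vY c : ℝ}

lemma memLp_left (h : IsGaussianPair P X Y vX vY c) : MemLp X 4 P := by
  simpa using memLp_of_map_eq_gaussianReal (h 1 0).2 4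

lemma memLp_right (h : IsGaussianPair P X Y vX vY c) : MemLp Y 4 P := by
  simpa using memLp_of_map_eq_gaussianReal (h 0 1).2 4

lemma integral_sq_left (h : IsGaussianPair P X Y vX vY c) : ∫ ω, X ω ^ 2 ∂P = vX := by
  have := integral_pow_two_of_map_eq_gaussianReal (h 1 0).1 (h 1 0).2
  simpa using this

lemma sq_mul_sq_eq (x y : ℝ) :
    x ^ 2 * y ^ 2 = (1 / 12) * ((x + y) ^ 4 + (x - y) ^ 4) - (1 / 6) * (x ^ 4 + y ^ 4) := by
  ring

lemma integrable_sq_mul_sq (h : IsGaussianPair P X Y vX vY c) :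
    Integrable (fun ω => X ω ^ 2 * Y ω ^ 2) P := by
  simp_rw [sq_mul_sq_eq]
  have hX := h.memLp_left
  have hY := h.memLp_right
  exact (((integrable_pow_four (hX.add hY)).add
    (integrable_pow_four (hX.sub hY))).const_mul _).sub
    (((integrable_pow_four hX).add (integrable_pow_four hY)).const_mul _)

lemma integral_sq_mul_sq (h : IsGaussianPair P X Y vX vY c) :
    ∫ ω, X ω ^ 2 * Y ω ^ 2 ∂P = vX * vY + 2 * c ^ 2 := by
  simp_rw [sq_mul_sq_eq]
  have hX := h.memLp_left
  have hY := h.memLp_right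
  have i1 : Integrable (fun ω => (X ω + Y ω) ^ 4) P := integrable_pow_four (hX.add hY)
  have i2 : Integrable (fun ω => (X ω - Y ω) ^ 4) P := integrable_pow_four (hX.sub hY)
  have i3 := integrable_pow_four hX
  have i4 := integrable_pow_four hY
  have e1 : ∫ ω, (X ω + Y ω) ^ 4 ∂P = 3 * (vX + 2 * c + vY) ^ 2 := by
    simpa using integral_pow_four_of_map_eq_gaussianReal (h 1 1).1 (h 1 1).2
  have e2 : ∫ ω, (X ω - Y ω) ^ 4 ∂P = 3 * (vX + -(2 * c) + vY) ^ 2 := by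
    simpa [← sub_eq_add_neg] using
      integral_pow_four_of_map_eq_gaussianReal (h 1 (-1)).1 (h 1 (-1)).2
  have e3 : ∫ ω, X ω ^ 4 ∂P = 3 * vX ^ 2 := by
    simpa using integral_pow_four_of_map_eq_gaussianReal (h 1 0).1 (h 1 0).2
  have e4 : ∫ ω, Y ω ^ 4 ∂P = 3 * vY ^ 2 := by
    simpa using integral_pow_four_of_map_eq_gaussianReal (h 0 1).1 (h 0 1).2
  have i12 : Integrable (fun ω => 1 / 12 * ((X ω + Y ω) ^ 4 + (X ω - Y ω) ^ 4)) P :=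
    (i1.add i2).const_mul _
  have i34 : Integrable (fun ω => 1 / 6 * (X ω ^ 4 + Y ω ^ 4)) P := (i3.add i4).const_mul _
  rw [integral_sub i12 i34, integral_const_mul,
    integral_const_mul, integral_add i1 i2, integral_add i3 i4, e1, e2, e3, e4]
  ring

end IsGaussianPair

/-- Mean square deviation of a sum of squares of jointly Gaussian variables. -/
lemma integral_sum_sq_sub_sq [IsProbabilityMeasure P] (s : Finset ℕ) (Δ : ℕ → Ω → ℝ)
    (D : ℕ → ℕ → ℝ) (c : ℝ)
    (h : ∀ j ∈ s, ∀ k ∈ s, IsGaussianPair P (Δ j) (Δ k) (D j j) (D k k) (D j k)) :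
    Integrable (fun ω => (∑ j ∈ s, Δ j ω ^ 2 - c) ^ 2) P ∧
    ∫ ω, (∑ j ∈ s, Δ j ω ^ 2 - c) ^ 2 ∂P
      = (∑ j ∈ s, D j j - c) ^ 2 + 2 * ∑ j ∈ s, ∑ k ∈ s, D j k ^ 2 := by
  have key : ∀ x : ℕ → ℝ, (∑ j ∈ s, x j ^ 2 - c) ^ 2
      = (∑ j ∈ s, ∑ k ∈ s, x j ^ 2 * x k ^ 2) - (2 * c) * (∑ j ∈ s, x j ^ 2) + c ^ 2 := by
    intro x
    rw [← Finset.sum_mul_sum]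
    ring
  have i1 : Integrable (fun ω => ∑ j ∈ s, ∑ k ∈ s, Δ j ω ^ 2 * Δ k ω ^ 2) P :=
    integrable_finsetSum _ fun j hj => integrable_finsetSum _ fun k hk =>
      (h j hj k hk).integrable_sq_mul_sq
  have i0 : ∀ j ∈ s, Integrable (fun ω => Δ j ω ^ 2) P := fun j hj =>
    ((h j hj j hj).memLp_left.mono_exponent (by norm_num)).integrable_sq
  have i2 : Integrable (fun ω => (2 * c) * ∑ j ∈ s, Δ j ω ^ 2) P :=
    (integrable_finsetSum _ i0).const_mul _
  simp_rw [fun ω => key (fun j => Δ j ω)]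
  have i12 : Integrable (fun ω => (∑ j ∈ s, ∑ k ∈ s, Δ j ω ^ 2 * Δ k ω ^ 2)
      - (2 * c) * ∑ j ∈ s, Δ j ω ^ 2) P := i1.sub i2
  refine ⟨i12.add (integrable_const _), ?_⟩
  rw [integral_add i12 (integrable_const _), integral_sub i1 i2, integral_const_mul,
    integral_finsetSum _ i0, integral_finsetSum _ (fun j hj => integrable_finsetSum _ fun k hk =>
      (h j hj k hk).integrable_sq_mul_sq)]
  have e1 : ∀ j ∈ s, ∫ ω, ∑ k ∈ s, Δ j ω ^ 2 * Δ k ω ^ 2 ∂P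
      = ∑ k ∈ s, (D j j * D k k + 2 * D j k ^ 2) := by
    intro j hj
    rw [integral_finsetSum _ (fun k hk => (h j hj k hk).integrable_sq_mul_sq)]
    exact Finset.sum_congr rfl fun k hk => (h j hj k hk).integral_sq_mul_sq
  rw [Finset.sum_congr rfl e1, Finset.sum_congr rfl fun j hj => (h j hj j hj).integral_sq_left]
  simp only [Finset.sum_add_distrib, ← Finset.mul_sum, ← Finset.sum_mul]
  simp
  ring

end Gaussian

lemma hasSum_cos_div_sq {z : ℝ} (h0 : 0 ≤ z) (h1 : z ≤ 2 * π) :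
    HasSum (fun k : ℕ => cos (((k : ℝ) + 1) * z) / ((k : ℝ) + 1) ^ 2)
      (π ^ 2 / 6 - π * z / 2 + z ^ 2 / 4) := by
  have hx : z / (2 * π) ∈ Set.Icc (0 : ℝ) 1 :=
    ⟨by positivity, by rw [div_le_one (by positivity)]; exact h1⟩
  have h := hasSum_one_div_nat_pow_mul_cos one_ne_zero hx
  rw [show (Polynomial.map (algebraMap ℚ ℝ) (Polynomial.bernoulli (2 * 1))).eval (z / (2 * π))
    = bernoulliFun 2 (z / (2 * π)) from rfl, bernoulliFun_two, ← hasSum_nat_add_iff' 1] at h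
  convert! h using 1
  · funext k
    push_cast
    rw [show 2 * π * ((k : ℝ) + 1) * (z / (2 * π)) = (k + 1) * z by field_simp]
    ring
  · simp
    field_simp
    ring

lemma hasSum_sin_mul_sin_div_sq {x y : ℝ} (hy : 0 ≤ y) (hyx : y ≤ x) (hx : x ≤ π) :
    HasSum (fun k : ℕ => sin (((k : ℝ) + 1) * x) * sin (((k : ℝ) + 1) * y) / ((k : ℝ) + 1) ^ 2)
      (y * (π - x) / 2) := by
  have h := ((hasSum_cos_div_sq (z := x - y) (by linarith) (by linarith [pi_pos])).sub
    (hasSum_cos_div_sq (z := x + y) (by linarith) (by linarith))).div_const 2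
  convert! h using 1
  · funext k
    rw [mul_sub, mul_add, cos_sub, cos_add]
    ring
  · ring

/-- The smooth correction by which `heatCovSpace` differs from a multiple of the
Brownian bridge covariance on `[0, π]`. -/
def heatCovRemainder (θ σ t x y : ℝ) : ℝ :=
  ∑' k : ℕ, σ ^ 2 / (θ * π) * exp (-(2 * θ * ((k : ℝ) + 1) ^ 2 * t)) / ((k : ℝ) + 1) ^ 2 *
    sin (((k : ℝ) + 1) * x) * sin (((k : ℝ) + 1) * y)

section Covariance

variable {θ σ t : ℝ}

lemma summable_exp_neg_sq (hθ : 0 < θ) (ht : 0 < t) :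
    Summable fun k : ℕ => exp (-(2 * θ * ((k : ℝ) + 1) ^ 2 * t)) := by
  have h : Summable fun k : ℕ => exp ((k : ℝ) * (-(2 * θ * t))) :=
    Real.summable_exp_nat_mul_iff.2 (by nlinarith [mul_pos hθ ht])
  refine Summable.of_nonneg_of_le (fun _ => (exp_pos _).le) (fun k => exp_le_exp.2 ?_) h
  have hk : (0 : ℝ) ≤ k := Nat.cast_nonneg k
  have := mul_pos hθ ht
  nlinarith [mul_nonneg this.le (show (0 : ℝ) ≤ (k + 1) ^ 2 - k by nlinarith)]

lemma summable_heatCovRemainder (hθ : 0 < θ) (ht : 0 < t) (x y : ℝ) :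
    Summable fun k : ℕ =>
      σ ^ 2 / (θ * π) * exp (-(2 * θ * ((k : ℝ) + 1) ^ 2 * t)) / ((k : ℝ) + 1) ^ 2 *
        sin (((k : ℝ) + 1) * x) * sin (((k : ℝ) + 1) * y) := by
  refine Summable.of_norm_bounded ((summable_exp_neg_sq hθ ht).mul_left (σ ^ 2 / (θ * π)))
    fun k => ?_
  have hk : (1 : ℝ) ≤ ((k : ℝ) + 1) ^ 2 := by
    have : (0 : ℝ) ≤ k := Nat.cast_nonneg k
    nlinarith
  have hA : 0 ≤ σ ^ 2 / (θ * π) * exp (-(2 * θ * ((k : ℝ) + 1) ^ 2 * t)) := by positivity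
  rw [norm_mul, norm_mul, norm_div, Real.norm_of_nonneg hA, Real.norm_of_nonneg (sq_nonneg _)]
  calc _ ≤ σ ^ 2 / (θ * π) * exp (-(2 * θ * ((k : ℝ) + 1) ^ 2 * t)) / 1 * 1 * 1 := by
        gcongr
        · exact abs_sin_le_one _
        · exact abs_sin_le_one _
    _ = _ := by ring

lemma hasSum_heatCovSpace (hθ : 0 < θ) (ht : 0 < t) {x y : ℝ}
    (hy : 0 ≤ y) (hyx : y ≤ x) (hx : x ≤ π) :
    HasSum (fun k : ℕ => (σ ^ 2 / (θ * π * ((k : ℝ) + 1) ^ 2)) *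
      (1 - exp (-(2 * θ * ((k : ℝ) + 1) ^ 2 * t))) *
      sin (((k : ℝ) + 1) * x) * sin (((k : ℝ) + 1) * y))
      (σ ^ 2 / (θ * π) * (y * (π - x) / 2) - heatCovRemainder θ σ t x y) := by
  have h := ((hasSum_sin_mul_sin_div_sq hy hyx hx).mul_left (σ ^ 2 / (θ * π))).sub
    (summable_heatCovRemainder (σ := σ) hθ ht x y).hasSum
  convert! h using 1
  funext k
  have : (k : ℝ) + 1 ≠ 0 := by positivity
  field_simp

lemma heatCovSpace_comm (x y : ℝ) : heatCovSpace θ σ t x y = heatCovSpace θ σ t y x :=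
  tsum_congr fun k => by ring

lemma heatCovSpace_eq (hθ : 0 < θ) (ht : 0 < t) {x y : ℝ}
    (hy : 0 ≤ y) (hyx : y ≤ x) (hx : x ≤ π) :
    heatCovSpace θ σ t x y
      = σ ^ 2 / (θ * π) * (y * (π - x) / 2) - heatCovRemainder θ σ t x y :=
  (hasSum_heatCovSpace hθ ht hy hyx hx).tsum_eq

lemma summable_heatCovSpace (hθ : 0 < θ) (ht : 0 < t) {x y : ℝ}
    (hx : x ∈ Set.Icc 0 π) (hy : y ∈ Set.Icc 0 π) :
    Summable (fun k : ℕ => (σ ^ 2 / (θ * π * ((k : ℝ) + 1) ^ 2)) *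
      (1 - exp (-(2 * θ * ((k : ℝ) + 1) ^ 2 * t))) *
      sin (((k : ℝ) + 1) * x) * sin (((k : ℝ) + 1) * y)) := by
  rcases le_total y x with h | h
  · exact (hasSum_heatCovSpace hθ ht hy.1 h hx.2).summable
  · exact (hasSum_heatCovSpace (σ := σ) hθ ht hx.1 h hy.2).summable.congr fun k => by ring

lemma sum_heatCovSpace_nonneg (hθ : 0 < θ) (ht : 0 < t) {n : ℕ} (x : Fin n → ℝ)
    (hx : ∀ i, x i ∈ Set.Icc 0 π) (c : Fin n → ℝ) :
    0 ≤ ∑ i, ∑ j, c i * c j * heatCovSpace θ σ t (x i) (x j) := by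
  have hs := fun i j => (summable_heatCovSpace (σ := σ) hθ ht (hx i) (hx j)).mul_left (c i * c j)
  simp only [heatCovSpace, ← tsum_mul_left]
  simp_rw [← Summable.tsum_finsetSum fun j _ => hs _ j]
  rw [← Summable.tsum_finsetSum fun i _ => summable_sum fun j _ => hs i j]
  refine tsum_nonneg fun k => ?_
  have h1 : exp (-(2 * θ * ((k : ℝ) + 1) ^ 2 * t)) ≤ 1 :=
    exp_le_one_iff.2 (neg_nonpos.2 (by positivity))
  have : ∑ i, ∑ j, c i * c j * ((σ ^ 2 / (θ * π * ((k : ℝ) + 1) ^ 2)) *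
      (1 - exp (-(2 * θ * ((k : ℝ) + 1) ^ 2 * t))) *
      sin (((k : ℝ) + 1) * x i) * sin (((k : ℝ) + 1) * x j))
      = (σ ^ 2 / (θ * π * ((k : ℝ) + 1) ^ 2)) * (1 - exp (-(2 * θ * ((k : ℝ) + 1) ^ 2 * t))) *
        ((∑ i, c i * sin (((k : ℝ) + 1) * x i)) * ∑ j, c j * sin (((k : ℝ) + 1) * x j)) := by
    rw [Finset.sum_mul_sum, Finset.mul_sum]
    refine Finset.sum_congr rfl fun i _ => ?_
    rw [Finset.mul_sum]
    exact Finset.sum_congr rfl fun j _ => by ring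
  rw [this]
  have h2 : 0 ≤ 1 - exp (-(2 * θ * ((k : ℝ) + 1) ^ 2 * t)) := by linarith
  exact mul_nonneg (by positivity) (mul_self_nonneg _)

lemma abs_rectIncr_heatCovRemainder_le (hθ : 0 < θ) (ht : 0 < t) (x x' y y' : ℝ) :
    |heatCovRemainder θ σ t x' y' - heatCovRemainder θ σ t x' y - heatCovRemainder θ σ t x y'
        + heatCovRemainder θ σ t x y|
      ≤ σ ^ 2 / (θ * π) * (∑' k : ℕ, exp (-(2 * θ * ((k : ℝ) + 1) ^ 2 * t)))
        * |x' - x| * |y' - y| := by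
  have hs := summable_heatCovRemainder (σ := σ) hθ ht
  have hr := fun x y => (hs x y).hasSum
  have h := (((hr x' y').sub (hr x' y)).sub (hr x y')).add (hr x y)
  have hb := ((((summable_exp_neg_sq hθ ht).hasSum.mul_left (σ ^ 2 / (θ * π))).mul_right
    |x' - x|).mul_right |y' - y|)
  rw [← Real.norm_eq_abs]
  unfold heatCovRemainder
  rw [← h.tsum_eq, ← hb.tsum_eq]
  refine tsum_of_norm_bounded hb.summable.hasSum fun k => ?_
  have hk : (0 : ℝ) < (k : ℝ) + 1 := by positivity
  have hA : 0 ≤ σ ^ 2 / (θ * π) * exp (-(2 * θ * ((k : ℝ) + 1) ^ 2 * t)) := by positivity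
  have hsin : ∀ a b : ℝ, |sin (((k : ℝ) + 1) * a) - sin (((k : ℝ) + 1) * b)|
      ≤ ((k : ℝ) + 1) * |a - b| := fun a b => by
    have := Real.abs_sin_sub_sin_le (((k : ℝ) + 1) * a) (((k : ℝ) + 1) * b)
    rwa [← mul_sub, abs_mul, abs_of_pos hk] at this
  set A := σ ^ 2 / (θ * π) * exp (-(2 * θ * ((k : ℝ) + 1) ^ 2 * t))
  calc _ = ‖A / ((k : ℝ) + 1) ^ 2 * ((sin (((k : ℝ) + 1) * x') - sin (((k : ℝ) + 1) * x))
          * (sin (((k : ℝ) + 1) * y') - sin (((k : ℝ) + 1) * y)))‖ := by congr 1; ring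
    _ = A / ((k : ℝ) + 1) ^ 2 * (|sin (((k : ℝ) + 1) * x') - sin (((k : ℝ) + 1) * x)|
          * |sin (((k : ℝ) + 1) * y') - sin (((k : ℝ) + 1) * y)|) := by
        rw [norm_mul, norm_mul, Real.norm_of_nonneg (by positivity)]; rfl
    _ ≤ A / ((k : ℝ) + 1) ^ 2 * ((((k : ℝ) + 1) * |x' - x|) * (((k : ℝ) + 1) * |y' - y|)) := by
        gcongr
        · exact hsin _ _
        · exact hsin _ _
    _ = _ := by field_simp

/-- Covariance of the increments of the field over `[x, x']` and `[y, y']`. -/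
def heatIncrCov (θ σ t x x' y y' : ℝ) : ℝ :=
  heatCovSpace θ σ t x' y' - heatCovSpace θ σ t x' y - heatCovSpace θ σ t x y'
    + heatCovSpace θ σ t x y

lemma heatIncrCov_comm (x x' y y' : ℝ) :
    heatIncrCov θ σ t x x' y y' = heatIncrCov θ σ t y y' x x' := by
  simp only [heatIncrCov, heatCovSpace_comm x, heatCovSpace_comm x']
  ring

lemma exists_heatIncrCov_bounds (hθ : 0 < θ) (ht : 0 < t) :
    ∃ M : ℝ, 0 ≤ M ∧
      (∀ x x', 0 ≤ x → x ≤ x' → x' ≤ π →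
        |heatIncrCov θ σ t x x' x x' - σ ^ 2 / (2 * θ) * (x' - x)| ≤ M * (x' - x) ^ 2) ∧
      ∀ x x' y y', 0 ≤ x → x ≤ x' → x' ≤ y → y ≤ y' → y' ≤ π →
        |heatIncrCov θ σ t x x' y y'| ≤ M * ((x' - x) * (y' - y)) := by
  set R := σ ^ 2 / (θ * π) * ∑' k : ℕ, exp (-(2 * θ * ((k : ℝ) + 1) ^ 2 * t)) with hR
  have hR0 : 0 ≤ R := mul_nonneg (by positivity) (tsum_nonneg fun _ => (exp_pos _).le)
  have hB0 : 0 ≤ σ ^ 2 / (2 * (θ * π)) := by positivity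
  have hpi := pi_pos
  refine ⟨σ ^ 2 / (2 * (θ * π)) + R, by positivity, ?_, ?_⟩
  · intro x x' hx hxx hx'
    have hb := abs_rectIncr_heatCovRemainder_le (σ := σ) hθ ht x x' x x'
    rw [← hR, abs_of_nonneg (sub_nonneg.2 hxx)] at hb
    have e : heatIncrCov θ σ t x x' x x' - σ ^ 2 / (2 * θ) * (x' - x)
        = -(σ ^ 2 / (2 * (θ * π)) * (x' - x) ^ 2)
          - (heatCovRemainder θ σ t x' x' - heatCovRemainder θ σ t x' x
            - heatCovRemainder θ σ t x x' + heatCovRemainder θ σ t x x) := by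
      have hc : heatCovRemainder θ σ t x x' = heatCovRemainder θ σ t x' x :=
        tsum_congr fun k => by ring
      rw [heatIncrCov, heatCovSpace_comm x x', heatCovSpace_eq hθ ht (hx.trans hxx) le_rfl hx',
        heatCovSpace_eq hθ ht hx hxx hx', heatCovSpace_eq hθ ht hx le_rfl (hxx.trans hx'), hc]
      field_simp
      ring
    rw [e]
    refine (abs_sub _ _).trans ?_
    rw [abs_neg, abs_of_nonneg (by positivity)]
    linarith
  · intro x x' y y' hx hxx hxy hyy hy'
    have hb := abs_rectIncr_heatCovRemainder_le (σ := σ) hθ ht y y' x x'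
    rw [← hR, abs_of_nonneg (sub_nonneg.2 hxx), abs_of_nonneg (sub_nonneg.2 hyy)] at hb
    have e : heatIncrCov θ σ t y y' x x'
        = -(σ ^ 2 / (2 * (θ * π)) * ((x' - x) * (y' - y)))
          - (heatCovRemainder θ σ t y' x' - heatCovRemainder θ σ t y' x
            - heatCovRemainder θ σ t y x' + heatCovRemainder θ σ t y x) := by
      rw [heatIncrCov, heatCovSpace_eq hθ ht (hx.trans hxx) (hxy.trans hyy) hy',
        heatCovSpace_eq hθ ht hx (hxx.trans (hxy.trans hyy)) hy',
        heatCovSpace_eq hθ ht (hx.trans hxx) hxy (hyy.trans hy'),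
        heatCovSpace_eq hθ ht hx (hxx.trans hxy) (hyy.trans hy')]
      field_simp
      ring
    rw [heatIncrCov_comm, e]
    refine (abs_sub _ _).trans ?_
    have : 0 ≤ (x' - x) * (y' - y) := mul_nonneg (by linarith) (by linarith)
    rw [abs_neg, abs_of_nonneg (mul_nonneg hB0 this)]
    linarith

end Covariance

lemma tendstoInMeasure_of_integral_sq_sub_le {Ω : Type*} [MeasurableSpace Ω] {P : Measure Ω}
    [IsProbabilityMeasure P] {f : ℕ → Ω → ℝ} {c : ℝ} {B : ℕ → ℝ}
    (hB : Tendsto B atTop (nhds 0))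
    (h : ∀ᶠ m in atTop, Integrable (fun ω => (f m ω - c) ^ 2) P ∧
      ∫ ω, (f m ω - c) ^ 2 ∂P ≤ B m) :
    TendstoInMeasure P f atTop (fun _ => c) := by
  rw [tendstoInMeasure_iff_measureReal_dist]
  intro ε hε
  have hB' : Tendsto (fun m => B m / ε ^ 2) atTop (nhds 0) := by simpa using hB.div_const (ε ^ 2)
  refine squeeze_zero' (Eventually.of_forall fun _ => measureReal_nonneg) ?_ hB'
  filter_upwards [h] with m ⟨hi, hm⟩
  rw [le_div_iff₀ (by positivity), mul_comm]
  have hset : {ω | ε ≤ dist (f m ω) c} = {ω | ε ^ 2 ≤ (f m ω - c) ^ 2} := by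
    ext ω
    simp only [Set.mem_ofPred_eq, Real.dist_eq]
    rw [← sq_abs (f m ω - c), sq_le_sq₀ hε.le (abs_nonneg _)]
  rw [hset]
  exact (mul_meas_ge_le_integral_of_nonneg
    (Eventually.of_forall fun ω => sq_nonneg (f m ω - c)) hi _).trans hm

lemma IsCenteredGaussianField.isGaussianPair_sub {Ω : Type*} [MeasurableSpace Ω] {P : Measure Ω}
    {θ σ t : ℝ} (hθ : 0 < θ) (ht : 0 < t) {u : ℝ → Ω → ℝ}
    (hu : IsCenteredGaussianField P u (Set.Icc 0 π) (heatCovSpace θ σ t)) {x x' y y' : ℝ}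
    (hx : x ∈ Set.Icc 0 π) (hx' : x' ∈ Set.Icc 0 π) (hy : y ∈ Set.Icc 0 π)
    (hy' : y' ∈ Set.Icc 0 π) :
    IsGaussianPair P (fun ω => u x' ω - u x ω) (fun ω => u y' ω - u y ω)
      (heatIncrCov θ σ t x x' x x') (heatIncrCov θ σ t y y' y y')
      (heatIncrCov θ σ t x x' y y') := by
  intro p q
  have hmem : ∀ i, ![x', x, y', y] i ∈ Set.Icc 0 π := by
    intro i
    fin_cases i <;> assumption
  have h0 := sum_heatCovSpace_nonneg (σ := σ) hθ ht _ hmem ![p, -p, q, -q]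
  have h1 := hu 4 _ hmem ![p, -p, q, -q]
  have e : ∑ i, ∑ j, ![p, -p, q, -q] i * ![p, -p, q, -q] j *
      heatCovSpace θ σ t (![x', x, y', y] i) (![x', x, y', y] j)
      = p ^ 2 * heatIncrCov θ σ t x x' x x' + 2 * p * q * heatIncrCov θ σ t x x' y y'
        + q ^ 2 * heatIncrCov θ σ t y y' y y' := by
    simp only [Fin.sum_univ_four, heatIncrCov]
    simp only [Matrix.cons_val]
    rw [heatCovSpace_comm y' x', heatCovSpace_comm y' x, heatCovSpace_comm y x',
      heatCovSpace_comm y x]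
    ring
  rw [e] at h0 h1
  refine ⟨h0, ?_⟩
  rw [← h1]
  congr 1
  funext ω
  simp [Fin.sum_univ_four]
  ring

lemma sum_sum_sq_le {m : ℕ} {D : ℕ → ℕ → ℝ} {d e : ℝ}
    (hd : ∀ j ∈ Finset.range m, |D j j - d| ≤ e)
    (he : ∀ j ∈ Finset.range m, ∀ k ∈ Finset.range m, j ≠ k → |D j k| ≤ e) :
    (∑ j ∈ Finset.range m, D j j - m * d) ^ 2
        + 2 * ∑ j ∈ Finset.range m, ∑ k ∈ Finset.range m, D j k ^ 2
      ≤ (m * e) ^ 2 + 2 * (m * (2 * d ^ 2) + m ^ 2 * (2 * e ^ 2)) := by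
  have h1 : |∑ j ∈ Finset.range m, D j j - m * d| ≤ m * e := by
    have : ∑ j ∈ Finset.range m, D j j - m * d = ∑ j ∈ Finset.range m, (D j j - d) := by
      simp [Finset.sum_sub_distrib]
    rw [this]
    exact (Finset.abs_sum_le_sum_abs _ _).trans ((Finset.sum_le_sum hd).trans_eq (by simp))
  have h2 : ∀ j ∈ Finset.range m, ∀ k ∈ Finset.range m,
      D j k ^ 2 ≤ (if j = k then 2 * d ^ 2 else 0) + 2 * e ^ 2 := by
    intro j hj k hk
    split_ifs with hjk
    · subst hjk
      have := sq_le_sq' (abs_le.1 (hd j hj)).1 (abs_le.1 (hd j hj)).2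
      nlinarith [sq_nonneg (D j j - 2 * d)]
    · have := abs_le.1 (he j hj k hk hjk)
      nlinarith [sq_le_sq' this.1 this.2, sq_nonneg e]
  have h3 : ∑ j ∈ Finset.range m, ∑ k ∈ Finset.range m, D j k ^ 2
      ≤ m * (2 * d ^ 2) + m ^ 2 * (2 * e ^ 2) := by
    refine (Finset.sum_le_sum fun j hj => Finset.sum_le_sum (h2 j hj)).trans_eq ?_
    simp only [Finset.sum_add_distrib, Finset.sum_ite_eq, Finset.sum_const, Finset.card_range,
      nsmul_eq_mul, Finset.sum_ite_mem, Finset.inter_self]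
    ring
  have := sq_le_sq' (abs_le.1 h1).1 (abs_le.1 h1).2
  linarith

/-- Consistency in probability of the volatility estimator `σ̂²_{m,t}` built from the
spatial quadratic variation of the stochastic heat equation observed at a fixed time `t`
on the uniform grid of `[a,b] ⊂ [0,π]`. -/
theorem stmt12 {Ω : Type*} [MeasurableSpace Ω] (P : Measure Ω) [IsProbabilityMeasure P]
    (θ σ t a b : ℝ) (hθ : 0 < θ) (hσ : 0 < σ) (ht : 0 < t)
    (ha : 0 ≤ a) (hab : a < b) (hb : b ≤ π)
    (u : ℝ → Ω → ℝ)
    (hu : IsCenteredGaussianField P u (Set.Icc 0 π) (heatCovSpace θ σ t)) :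
    TendstoInMeasure P
      (fun (m : ℕ) ω => (2 * θ / (b - a)) * ∑ j ∈ Finset.range m,
        (u (a + (b - a) * ((j : ℝ) + 1) / (m : ℝ)) ω
          - u (a + (b - a) * (j : ℝ) / (m : ℝ)) ω) ^ 2)
      atTop (fun _ => σ ^ 2) := by
  obtain ⟨M, hM, hdiag, hoff⟩ := exists_heatIncrCov_bounds (σ := σ) hθ ht
  have hL : 0 < b - a := sub_pos.2 hab
  set L := b - a with hLdef
  set s := σ ^ 2 / (2 * θ) with hs
  have hB : Tendsto (fun m : ℕ => (2 * θ / L) ^ 2 * ((M * L ^ 2) ^ 2 * ((m : ℝ)⁻¹) ^ 2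
      + 2 * (2 * (s * L) ^ 2 * (m : ℝ)⁻¹ + 2 * (M * L ^ 2) ^ 2 * ((m : ℝ)⁻¹) ^ 2)))
      atTop (nhds 0) := by
    have h := tendsto_inv_atTop_nhds_zero_nat (𝕜 := ℝ)
    have h2 := h.pow 2
    have := (((h2.const_mul ((M * L ^ 2) ^ 2)).add (((h.const_mul (2 * (s * L) ^ 2)).add
      (h2.const_mul (2 * (M * L ^ 2) ^ 2))).const_mul 2)).const_mul ((2 * θ / L) ^ 2))
    simpa using this
  refine tendstoInMeasure_of_integral_sq_sub_le hB ?_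
  filter_upwards [eventually_ge_atTop 1] with m hm
  have hm0 : (0 : ℝ) < m := by exact_mod_cast hm
  set x : ℝ → ℝ := fun r => a + L * r / m with hx
  have hmono : Monotone x := fun r r' h => by simp only [hx]; gcongr
  have hx0 : x 0 = a := by simp [hx]
  have hxm : x m = b := by simp only [hx]; rw [mul_div_cancel_right₀ _ hm0.ne']; simp [hLdef]
  have hlow : ∀ j : ℕ, 0 ≤ x j := fun j => ha.trans (hx0 ▸ hmono (Nat.cast_nonneg j))
  have hupp : ∀ j : ℕ, j < m → x (j + 1) ≤ π := fun j hj =>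
    (hmono (by exact_mod_cast hj)).trans (hxm.le.trans hb)
  have hstep : ∀ j : ℕ, x j ≤ x (j + 1) := fun j => hmono (by linarith)
  have hdx : ∀ j : ℕ, x (j + 1) - x j = L / m := fun j => by simp only [hx]; ring
  set D : ℕ → ℕ → ℝ := fun j k => heatIncrCov θ σ t (x j) (x (j + 1)) (x k) (x (k + 1)) with hD
  have hpair : ∀ j ∈ Finset.range m, ∀ k ∈ Finset.range m,
      IsGaussianPair P (fun ω => u (x (j + 1)) ω - u (x j) ω)
        (fun ω => u (x (k + 1)) ω - u (x k) ω) (D j j) (D k k) (D j k) := by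
    intro j hj k hk
    rw [Finset.mem_range] at hj hk
    exact hu.isGaussianPair_sub hθ ht ⟨hlow j, (hstep j).trans (hupp j hj)⟩
      ⟨(hlow j).trans (hstep j), hupp j hj⟩ ⟨hlow k, (hstep k).trans (hupp k hk)⟩
      ⟨(hlow k).trans (hstep k), hupp k hk⟩
  have hDdiag : ∀ j ∈ Finset.range m, |D j j - s * (L / m)| ≤ M * (L / m) ^ 2 := by
    intro j hj
    have := hdiag (x j) (x (j + 1)) (hlow j) (hstep j) (hupp j (Finset.mem_range.1 hj))
    rwa [hdx] at this
  have hlt : ∀ j k : ℕ, j < k → k < m → |D j k| ≤ M * (L / m) ^ 2 := by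
    intro j k hjk hk
    have := hoff (x j) (x (j + 1)) (x k) (x (k + 1)) (hlow j) (hstep j)
      (hmono (by exact_mod_cast hjk)) (hstep k) (hupp k hk)
    rwa [hdx, hdx, ← sq] at this
  have hDoff : ∀ j ∈ Finset.range m, ∀ k ∈ Finset.range m, j ≠ k →
      |D j k| ≤ M * (L / m) ^ 2 := by
    intro j hj k hk hjk
    rcases lt_or_gt_of_ne hjk with h | h
    · exact hlt j k h (Finset.mem_range.1 hk)
    · rw [hD]
      simp only
      rw [heatIncrCov_comm]
      exact hlt k j h (Finset.mem_range.1 hj)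
  obtain ⟨hint, hval⟩ := integral_sum_sq_sub_sq (Finset.range m)
    (fun j ω => u (x (j + 1)) ω - u (x j) ω) D (m * (s * (L / m))) hpair
  have hsq : ∀ ω, (2 * θ / L * ∑ j ∈ Finset.range m,
      (u (x (j + 1)) ω - u (x j) ω) ^ 2 - σ ^ 2) ^ 2
      = (2 * θ / L) ^ 2 * (∑ j ∈ Finset.range m, (u (x (j + 1)) ω - u (x j) ω) ^ 2
        - m * (s * (L / m))) ^ 2 := by
    intro ω
    rw [← mul_pow, mul_sub]
    congr 2
    rw [hs]
    field_simp
  change Integrable (fun ω => (2 * θ / L * ∑ j ∈ Finset.range m,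
      (u (x (j + 1)) ω - u (x j) ω) ^ 2 - σ ^ 2) ^ 2) P ∧
    ∫ ω, (2 * θ / L * ∑ j ∈ Finset.range m,
      (u (x (j + 1)) ω - u (x j) ω) ^ 2 - σ ^ 2) ^ 2 ∂P ≤ _
  simp_rw [hsq]
  refine ⟨hint.const_mul _, ?_⟩
  rw [integral_const_mul, hval]
  refine mul_le_mul_of_nonneg_left ?_ (sq_nonneg _)
  refine (sum_sum_sq_le hDdiag hDoff).trans_eq ?_
  field_simp
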